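/- Let f : [m,M] → ℝ be a continuous convex function, let A₁,…,Aₙ and B₁,…,Bₙ be selfadjoint bounded linear operators on a complex Hilbert space H with spectra contained in [m,M], and let p₁,…,pₙ be positive real numbers with ∑_{i=1}^n pᵢ = 1. Suppose ∑_{i=1}^n pᵢ Aᵢ = ∑_{i=1}^n pᵢ Bᵢ. Then for any α ≥ 0 and any real β such that a_f t + b_f − α f(t) ≤ β for all t ∈ [m,M], one has ∑_{i=1}^n pᵢ f(Aᵢ) ≤ β·1_H + α ∑_{i=1}^n pᵢ f(Bᵢ) in the Loewner order. -/

import Mathlib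

/-- A convex function on an interval lies below its chord. -/
theorem ConvexOn.le_chord {m M : ℝ} (hmM : m < M) {f : ℝ → ℝ}
    (hf : ConvexOn ℝ (Set.Icc m M) f) {t : ℝ} (ht : t ∈ Set.Icc m M) :
    f t ≤ ((f M - f m) / (M - m)) * t + (M * f m - m * f M) / (M - m) := by
  have hd : 0 < M - m := sub_pos.2 hmM
  have h := hf.2 (Set.left_mem_Icc.2 hmM.le) (Set.right_mem_Icc.2 hmM.le)
    (div_nonneg (sub_nonneg.2 ht.2) hd.le) (div_nonneg (sub_nonneg.2 ht.1) hd.le)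
    (by field_simp; ring)
  simp only [smul_eq_mul] at h
  have ht' : (M - t) / (M - m) * m + (t - m) / (M - m) * M = t := by
    field_simp
    ring
  rw [ht'] at h
  refine h.trans_eq ?_
  field_simp
  ring

/-- The functional calculus of an affine function. -/
theorem IsSelfAdjoint.cfc_affine {𝒜 : Type*} [CStarAlgebra 𝒜] {x : 𝒜} (hx : IsSelfAdjoint x)
    (a b : ℝ) : cfc (fun t : ℝ ↦ a * t + b) x = a • x + b • (1 : 𝒜) := by
  rw [cfc_add_const b (fun t ↦ a * t) x, cfc_const_mul_id a x, Algebra.algebraMap_eq_smul_one]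

theorem stmt2 {H : Type*}
    [NormedAddCommGroup H] [InnerProductSpace ℂ H] [CompleteSpace H]
    (m M : ℝ) (hmM : m < M) (f : ℝ → ℝ)
    (hconv : ConvexOn ℝ (Set.Icc m M) f) (hcont : ContinuousOn f (Set.Icc m M))
    (n : ℕ) (A B : Fin n → H →L[ℂ] H)
    (hA : ∀ i, IsSelfAdjoint (A i)) (hB : ∀ i, IsSelfAdjoint (B i))
    (hspecA : ∀ i, spectrum ℝ (A i) ⊆ Set.Icc m M)
    (hspecB : ∀ i, spectrum ℝ (B i) ⊆ Set.Icc m M)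
    (p : Fin n → ℝ) (hp : ∀ i, 0 < p i) (hp1 : ∑ i, p i = 1)
    (heq : ∑ i, p i • A i = ∑ i, p i • B i)
    (α : ℝ) (hα : 0 ≤ α) (β : ℝ)
    (hβ : ∀ t ∈ Set.Icc m M,
      ((f M - f m) / (M - m)) * t + (M * f m - m * f M) / (M - m) - α * f t ≤ β) :
    ∑ i, p i • cfc f (A i) ≤ β • (1 : H →L[ℂ] H) + α • ∑ i, p i • cfc f (B i) := by
  set a := (f M - f m) / (M - m)
  set b := (M * f m - m * f M) / (M - m)
  have hfA (i : Fin n) : cfc f (A i) ≤ a • A i + b • (1 : H →L[ℂ] H) := by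
    rw [← (hA i).cfc_affine]
    exact cfc_mono (fun t ht ↦ hconv.le_chord hmM (hspecA i ht)) (hcont.mono (hspecA i))
  have hfB (i : Fin n) : a • B i + b • (1 : H →L[ℂ] H) ≤ β • 1 + α • cfc f (B i) := by
    have hc : ContinuousOn f (spectrum ℝ (B i)) := hcont.mono (hspecB i)
    rw [← (hB i).cfc_affine, ← Algebra.algebraMap_eq_smul_one, ← cfc_const_mul α f (B i) hc,
      ← cfc_const_add β (fun t ↦ α * f t) (B i) (hc.const_smul α)]
    refine cfc_mono (fun t ht ↦ ?_) (by fun_prop) (by fun_prop)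
    linarith [hβ t (hspecB i ht)]
  have hsum (C : Fin n → H →L[ℂ] H) (a b : ℝ) (D : H →L[ℂ] H) :
      ∑ i, p i • (a • C i + b • D) = a • ∑ i, p i • C i + b • D := by
    simp only [smul_add, Finset.sum_add_distrib, smul_comm (p _), ← Finset.smul_sum,
      ← Finset.sum_smul, hp1, one_smul]
  calc
    ∑ i, p i • cfc f (A i) ≤ ∑ i, p i • (a • A i + b • (1 : H →L[ℂ] H)) :=
      Finset.sum_le_sum fun i _ ↦ smul_le_smul_of_nonneg_left (hfA i) (hp i).le
    _ = ∑ i, p i • (a • B i + b • (1 : H →L[ℂ] H)) := by rw [hsum, hsum, heq]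
    _ ≤ ∑ i, p i • (β • (1 : H →L[ℂ] H) + α • cfc f (B i)) :=
      Finset.sum_le_sum fun i _ ↦ smul_le_smul_of_nonneg_left (hfB i) (hp i).le
    _ = β • (1 : H →L[ℂ] H) + α • ∑ i, p i • cfc f (B i) := by
      rw [add_comm, ← hsum]
      simp only [add_comm]
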